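/- For x, w ∈ S_n, the following are equivalent: (i) x ≤ w in the Bruhat order (defined as the partial order generated by the covering-type relations u ≤ ut for transpositions t with l(u) < l(ut)); (ii) r_x(p,q) ≤ r_w(p,q) for all p, q ∈ {1,…,n}, i.e. d_{x,w} is everywhere non-negative. -/

import Mathlib

open scoped Classical

namespace BSW

/-- The number of inversions (the length) of a permutation of `Fin n`. -/
def invLen {n : ℕ} (w : Equiv.Perm (Fin n)) : ℕ :=
  (Finset.univ.filter (fun p : Fin n × Fin n => p.1 < p.2 ∧ w p.2 < w p.1)).card

/-- The rank function `r_w(p,q) = #{i : 1 ≤ i ≤ p and w(i) ≥ q}`, where the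
permutation of `Fin n` is regarded as a permutation of `{1,…,n}` (so position
`i : Fin n` corresponds to `i+1` and value `w i` to `(w i)+1`). -/
def rank {n : ℕ} (w : Equiv.Perm (Fin n)) (p q : ℤ) : ℕ :=
  (Finset.univ.filter (fun i : Fin n =>
    ((i : ℕ) : ℤ) + 1 ≤ p ∧ q ≤ ((w i : ℕ) : ℤ) + 1)).card

/-- The difference function `d_{x,w}(p,q) = r_w(p,q) − r_x(p,q)`. -/
def dxw {n : ℕ} (x w : Equiv.Perm (Fin n)) (p q : ℤ) : ℤ :=
  (rank w p q : ℤ) - (rank x p q : ℤ)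

/-- The Bruhat order: `x ≤ w` iff `d_{x,w}` is everywhere non-negative. -/
def bruhatLE {n : ℕ} (x w : Equiv.Perm (Fin n)) : Prop :=
  ∀ p q : ℤ, 0 ≤ dxw x w p q

/-- The set of transpositions in `S_n`. -/
def transpositions (n : ℕ) : Set (Equiv.Perm (Fin n)) :=
  {t | ∃ a b : Fin n, a ≠ b ∧ t = Equiv.swap a b}

/-- `R(x,w) = {t ∈ T : l(xt) > l(x) and xt ≤ w}`. -/
def R {n : ℕ} (x w : Equiv.Perm (Fin n)) : Set (Equiv.Perm (Fin n)) :=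
  {t | t ∈ transpositions n ∧ invLen x < invLen (x * t) ∧ bruhatLE (x * t) w}

/-- `x` is a maximal singular point (MSP) for `w`. -/
def MSP {n : ℕ} (x w : Equiv.Perm (Fin n)) : Prop :=
  bruhatLE x w ∧ ((invLen w : ℤ) - (invLen x : ℤ) < ((R x w).ncard : ℤ)) ∧
    ∀ t ∈ R x w, ((R (x * t) w).ncard : ℤ) = (invLen w : ℤ) - (invLen (x * t) : ℤ)

/-- `Δ(x,w) = {i : t_{{i,j}} ∈ R(x,w) for some j}`. -/
def Delta {n : ℕ} (x w : Equiv.Perm (Fin n)) : Set (Fin n) :=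
  {i | ∃ j : Fin n, Equiv.swap i j ∈ R x w}

/-- `Δ(x,w)` as a finset. -/
noncomputable def DeltaFinset {n : ℕ} (x w : Equiv.Perm (Fin n)) : Finset (Fin n) :=
  (Set.toFinite (Delta x w)).toFinset

/-- `σ ∈ S_k` is the flattening of `x` along the increasing enumeration `d_1 < … < d_k`
of a set `D` of positions with `#D = k`: the unique permutation of `{1,…,k}` with
`σ(a) < σ(b)` iff `x(d_a) < x(d_b)`. -/
def IsFlatteningOn {n k : ℕ} (x : Equiv.Perm (Fin n)) (D : Finset (Fin n))
    (hD : D.card = k) (σ : Equiv.Perm (Fin k)) : Prop :=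
  ∀ a b : Fin k, σ a < σ b ↔ x ((D.orderIsoOfFin hD a : Fin n)) < x ((D.orderIsoOfFin hD b : Fin n))

/-- Values (0-indexed) of the permutation `x_{k,m} = [k,…,1, k+m,…,k+1]`. -/
def xkmVal (k m i : ℕ) : ℕ :=
  if i < k then k - 1 - i else 2 * k + m - 1 - i

/-- Values (0-indexed) of the permutation `w_{k,m} = [k+m, k,…,2, k+m−1,…,k+1, 1]`. -/
def wkmVal (k m i : ℕ) : ℕ :=
  if i = 0 then k + m - 1
  else if i < k then k - i
  else if i < k + m - 1 then 2 * k + m - 2 - i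
  else 0

/-- Values (0-indexed) of the permutation `x_{k,l,m} = [k,…,1, k+l,…,k+1, k+l+m,…,k+l+1]`. -/
def xklmVal (k l m i : ℕ) : ℕ :=
  if i < k then k - 1 - i
  else if i < k + l then 2 * k + l - 1 - i
  else 2 * (k + l) + m - 1 - i

/-- Values (0-indexed) of the permutation
`w_{k,l,m} = [k+l, k,…,2, k+l+m, k+l−1,…,k+2, 1, k+l+m−1,…,k+l+1, k+1]`. -/
def wklmVal (k l m i : ℕ) : ℕ :=
  if i = 0 then k + l - 1
  else if i < k then k - i
  else if i = k then k + l + m - 1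
  else if i < k + l - 1 then 2 * k + l - 1 - i
  else if i = k + l - 1 then 0
  else if i < k + l + m - 1 then 2 * (k + l) + m - 2 - i
  else k


/-- The rank function with the contributions of two positions split off. -/
theorem rank_eq_add_sum {n : ℕ} (v : Equiv.Perm (Fin n)) {a b : Fin n} (hab : a ≠ b) (p q : ℤ) :
    rank v p q =
      (if ((a : ℕ) : ℤ) + 1 ≤ p ∧ q ≤ ((v a : ℕ) : ℤ) + 1 then 1 else 0) +
      ((if ((b : ℕ) : ℤ) + 1 ≤ p ∧ q ≤ ((v b : ℕ) : ℤ) + 1 then 1 else 0) +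
      ∑ i ∈ (Finset.univ.erase a).erase b,
        if ((i : ℕ) : ℤ) + 1 ≤ p ∧ q ≤ ((v i : ℕ) : ℤ) + 1 then 1 else 0) := by
  rw [rank, Finset.card_filter, ← Finset.add_sum_erase _ _ (Finset.mem_univ a),
    ← Finset.add_sum_erase (Finset.univ.erase a) _ (Finset.mem_erase.2 ⟨hab.symm, Finset.mem_univ b⟩)]

/-- Multiplying by a transposition of a non-inversion adds one to the rank function on a
rectangle, and leaves it unchanged elsewhere. -/
theorem rank_mul_swap {n : ℕ} (u : Equiv.Perm (Fin n)) {a b : Fin n} (hab : a < b)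
    (hu : u a < u b) (p q : ℤ) :
    rank (u * Equiv.swap a b) p q = rank u p q +
      if (((a : ℕ) : ℤ) < p ∧ p ≤ ((b : ℕ) : ℤ)) ∧
        (((u a : ℕ) : ℤ) + 1 < q ∧ q ≤ ((u b : ℕ) : ℤ) + 1) then 1 else 0 := by
  rw [rank_eq_add_sum _ hab.ne, rank_eq_add_sum u hab.ne]
  have hrest : ∀ i ∈ (Finset.univ.erase a).erase b,
      (if ((i : ℕ) : ℤ) + 1 ≤ p ∧ q ≤ (((u * Equiv.swap a b) i : ℕ) : ℤ) + 1 then 1 else 0) =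
        if ((i : ℕ) : ℤ) + 1 ≤ p ∧ q ≤ ((u i : ℕ) : ℤ) + 1 then 1 else 0 := by
    intro i hi
    simp only [Finset.mem_erase, Finset.mem_univ, and_true] at hi
    rw [Equiv.Perm.mul_apply, Equiv.swap_apply_of_ne_of_ne hi.2 hi.1]
  rw [Finset.sum_congr rfl hrest]
  simp only [Equiv.Perm.mul_apply, Equiv.swap_apply_left, Equiv.swap_apply_right]
  rw [Fin.lt_def] at hab hu
  split_ifs <;> omega

/-- Multiplying by a transposition of a non-inversion increases the length. -/
theorem invLen_lt_mul_swap {n : ℕ} (u : Equiv.Perm (Fin n)) {a b : Fin n} (hab : a < b)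
    (hu : u a < u b) : invLen u < invLen (u * Equiv.swap a b) := by
  set t := Equiv.swap a b with ht
  have htt : ∀ i, t (t i) = i := Equiv.swap_apply_self a b
  let f : Fin n × Fin n → Fin n × Fin n :=
    fun p => if t p.1 < t p.2 then (t p.1, t p.2) else p
  have hmem : ∀ i j, i < j → u j < u i → ¬ t i < t j → u (t j) < u (t i) := by
    intro i j hij huij hn
    rw [ht, Equiv.swap_apply_def, Equiv.swap_apply_def] at *
    grind
  unfold invLen
  rw [← Finset.card_image_of_injOn (f := f)]
  · apply Finset.card_lt_card
    rw [Finset.ssubset_iff_of_subset]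
    · refine ⟨(a, b), ?_, ?_⟩
      · simp [ht, hab, hu]
      · simp only [Finset.mem_image, Finset.mem_filter, Finset.mem_univ, true_and, Prod.exists,
          not_exists, not_and, and_imp, f]
        intro i j hij huij h
        split_ifs at h with hlt
        · rw [Prod.mk.injEq] at h
          have hi : i = b := by rw [← htt i, h.1, ht, Equiv.swap_apply_left]
          have hj : j = a := by rw [← htt j, h.2, ht, Equiv.swap_apply_right]
          rw [hi, hj] at hij
          exact lt_asymm hab hij
        · rw [Prod.mk.injEq] at h
          rw [h.1, h.2] at huij
          exact lt_asymm hu huij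
    · intro p hp
      simp only [Finset.mem_image, Finset.mem_filter, Finset.mem_univ, true_and, Prod.exists,
        f] at hp
      obtain ⟨i, j, ⟨hij, huij⟩, rfl⟩ := hp
      rw [Finset.mem_filter]
      refine ⟨Finset.mem_univ _, ?_⟩
      simp only [Equiv.Perm.mul_apply]
      split_ifs with hlt
      · simpa only [htt] using ⟨hlt, huij⟩
      · exact ⟨hij, hmem i j hij huij hlt⟩
  · rintro ⟨i, j⟩ hp ⟨k, l⟩ hq h
    simp only [Finset.coe_filter, Finset.mem_univ, true_and, Set.mem_ofPred_eq] at hp hq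
    simp only [f] at h
    split_ifs at h with h1 h2 h2 <;> grind

/-- A length-increasing transposition is the transposition of a non-inversion. -/
theorem exists_lt_of_invLen_lt_mul {n : ℕ} {u t : Equiv.Perm (Fin n)} (ht : t ∈ transpositions n)
    (h : invLen u < invLen (u * t)) : ∃ a b, a < b ∧ u a < u b ∧ t = Equiv.swap a b := by
  obtain ⟨a, b, hne, rfl⟩ := ht
  wlog hab : a < b generalizing a b
  · rw [Equiv.swap_comm] at h ⊢
    exact this b a hne.symm h (lt_of_le_of_ne (not_lt.1 hab) hne.symm)
  refine ⟨a, b, hab, ?_, rfl⟩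
  by_contra hu
  have hlt : u b < u a := lt_of_le_of_ne (not_lt.1 hu) (u.injective.ne hne.symm)
  have := invLen_lt_mul_swap (u * Equiv.swap a b) hab (by simpa using hlt)
  rw [mul_assoc, Equiv.swap_mul_self, mul_one] at this
  exact lt_asymm h this

theorem bruhatLE_iff {n : ℕ} {x w : Equiv.Perm (Fin n)} :
    bruhatLE x w ↔ ∀ p q, rank x p q ≤ rank w p q := by
  simp [bruhatLE, dxw]

theorem bruhatLE.trans {n : ℕ} {x y w : Equiv.Perm (Fin n)} (hxy : bruhatLE x y)
    (hyw : bruhatLE y w) : bruhatLE x w := by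
  rw [bruhatLE_iff] at *
  exact fun p q => (hxy p q).trans (hyw p q)

/-- Splitting the values counted by the rank function at a threshold. -/
theorem rank_eq_rank_add_card {n : ℕ} (v : Equiv.Perm (Fin n)) (p : ℤ) {q m : ℤ} (hqm : q ≤ m) :
    rank v p q = rank v p m + (Finset.univ.filter (fun i : Fin n =>
      ((i : ℕ) : ℤ) + 1 ≤ p ∧ q ≤ ((v i : ℕ) : ℤ) + 1 ∧ ((v i : ℕ) : ℤ) + 1 < m)).card := by
  unfold rank
  rw [← Finset.card_union_of_disjoint]
  · congr 1
    ext i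
    simp only [Finset.mem_filter, Finset.mem_univ, true_and, Finset.mem_union]
    omega
  · rw [Finset.disjoint_filter]
    intro i _ h1 h2
    omega

/-- At the first position where they differ, the smaller permutation has the smaller value. -/
theorem bruhatLE.apply_lt_of_forall_lt {n : ℕ} {x w : Equiv.Perm (Fin n)} (h : bruhatLE x w)
    {a : Fin n} (ha : x a ≠ w a) (hlt : ∀ i < a, x i = w i) : x a < w a := by
  by_contra hn
  have hwx : w a < x a := lt_of_le_of_ne (not_lt.1 hn) ha.symm
  rw [bruhatLE_iff] at h
  refine (h ((a : ℕ) + 1) ((x a : ℕ) + 1)).not_gt ?_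
  unfold rank
  apply Finset.card_lt_card
  rw [Finset.ssubset_iff_of_subset]
  · refine ⟨a, by simp, ?_⟩
    simp only [Finset.mem_filter, Finset.mem_univ, true_and]
    rw [Fin.lt_def] at hwx
    omega
  · intro i
    simp only [Finset.mem_filter, Finset.mem_univ, true_and]
    rintro ⟨h1, h2⟩
    rcases lt_trichotomy i a with hi | rfl | hi
    · rw [hlt i hi]
      exact ⟨h1, h2⟩
    · exact ⟨h1, le_rfl⟩
    · rw [Fin.lt_def] at hi
      omega

/-- If `x < w` for the rank condition, some length-increasing transposition of `x` stays
below `w`. -/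
theorem bruhatLE.exists_swap {n : ℕ} {x w : Equiv.Perm (Fin n)} (h : bruhatLE x w) (hne : x ≠ w) :
    ∃ a b, a < b ∧ x a < x b ∧ bruhatLE (x * Equiv.swap a b) w := by
  obtain ⟨a, ha, hmin⟩ : ∃ a, x a ≠ w a ∧ ∀ i < a, x i = w i := by
    have hex : ∃ a, x a ≠ w a := by
      by_contra! hall
      exact hne (Equiv.ext hall)
    obtain ⟨a, ha⟩ := exists_minimal_of_wellFoundedLT (fun a => x a ≠ w a) hex
    exact ⟨a, ha.1, fun i hi => not_not.1 fun hi' => ha.not_prop_of_lt hi hi'⟩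
  have hxw := h.apply_lt_of_forall_lt ha hmin
  obtain ⟨b, ⟨hab, hxb, hbw⟩, hbmin⟩ : ∃ b, (a < b ∧ x a < x b ∧ x b ≤ w a) ∧
      ∀ i < b, ¬ (a < i ∧ x a < x i ∧ x i ≤ w a) := by
    have hex : ∃ b, a < b ∧ x a < x b ∧ x b ≤ w a := by
      refine ⟨x.symm (w a), ?_, by simpa using hxw, by simp⟩
      rcases lt_trichotomy (x.symm (w a)) a with hi | hi | hi
      · have := hmin _ hi
        rw [Equiv.apply_symm_apply] at this
        exact absurd (w.injective this) hi.ne'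
      · exact absurd ((Equiv.symm_apply_eq x).1 hi) ha.symm
      · exact hi
    obtain ⟨b, hb⟩ := exists_minimal_of_wellFoundedLT
      (fun b => a < b ∧ x a < x b ∧ x b ≤ w a) hex
    exact ⟨b, hb.1, fun i hi => hb.not_prop_of_lt hi⟩
  refine ⟨a, b, hab, hxb, ?_⟩
  rw [bruhatLE_iff] at h ⊢
  intro p q
  rw [rank_mul_swap x hab hxb]
  split_ifs with hreg
  · obtain ⟨⟨hap, hpb⟩, hq, hqb⟩ := hreg
    rw [Fin.lt_def] at hxw
    rw [Fin.le_def] at hbw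
    have hqm : q ≤ ((w a : ℕ) : ℤ) + 2 := by omega
    rw [rank_eq_rank_add_card x p hqm, rank_eq_rank_add_card w p hqm, add_assoc]
    refine add_le_add (h p _) (Finset.card_lt_card ?_)
    rw [Finset.ssubset_iff_of_subset]
    · refine ⟨a, ?_, ?_⟩ <;> simp only [Finset.mem_filter, Finset.mem_univ, true_and] <;> omega
    · intro i
      simp only [Finset.mem_filter, Finset.mem_univ, true_and]
      rintro ⟨h1, h2, h3⟩
      rcases lt_trichotomy i a with hi | rfl | hi
      · rw [← hmin i hi]
        exact ⟨h1, h2, h3⟩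
      · omega
      · exact (hbmin i (Fin.lt_def.2 (by omega))
          ⟨hi, Fin.lt_def.2 (by omega), Fin.le_def.2 (by omega)⟩).elim
  · exact h p q

theorem invLen_le {n : ℕ} (u : Equiv.Perm (Fin n)) : invLen u ≤ n * n := by
  simpa [invLen] using Finset.card_filter_le (Finset.univ : Finset (Fin n × Fin n))
    (fun p => p.1 < p.2 ∧ u p.2 < u p.1)

/-- The Bruhat order defined as the reflexive-transitive closure of the relations
`u ≤ ut` (for transpositions `t` with `l(u) < l(ut)`) coincides with the rank
condition: `d_{x,w}` is everywhere non-negative. -/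
theorem bruhat_closure_iff_rank {n : ℕ} (x w : Equiv.Perm (Fin n)) :
    Relation.ReflTransGen
      (fun u v : Equiv.Perm (Fin n) =>
        ∃ t ∈ transpositions n, invLen u < invLen (u * t) ∧ v = u * t) x w
      ↔ bruhatLE x w := by
  constructor
  · intro h
    induction h with
    | refl => simp [bruhatLE, dxw]
    | tail _ hstep ih =>
      obtain ⟨t, ht, hlen, rfl⟩ := hstep
      obtain ⟨a, b, hab, hu, rfl⟩ := exists_lt_of_invLen_lt_mul ht hlen
      refine ih.trans (bruhatLE_iff.2 fun p q => ?_)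
      rw [rank_mul_swap _ hab hu]
      exact Nat.le_add_right _ _
  · intro h
    induction hk : n * n - invLen x using Nat.strong_induction_on generalizing x with
    | _ k ih =>
      by_cases hne : x = w
      · rw [hne]
      · obtain ⟨a, b, hab, hxab, hle⟩ := h.exists_swap hne
        have hlt := invLen_lt_mul_swap x hab hxab
        have hbound := invLen_le (x * Equiv.swap a b)
        exact (ih _ (by omega) _ hle rfl).head ⟨_, ⟨a, b, hab.ne, rfl⟩, hlt, rfl⟩

end BSW
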